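/- Let 𝔽 be ℝ or ℂ, let n ≥ 2 and K ≥ 2, and let 𝒫 be a probability measure on the K-fold product of the space of self-adjoint n×n matrices over 𝔽 that is absolutely continuous with respect to the Lebesgue measure on that (real) linear space. Then the set of self-adjoint tuples 𝒜 = (A_1,…,A_K) that possess a common nontrivial invariant subspace has 𝒫-measure zero; consequently, for 𝒫-almost every 𝒜, the functional f_𝒜(Q) tends to infinity as Q tends to any fixed nonzero rank-deficient matrix Z along invertible matrices. -/

import Mathlib

open Filter Topology Matrix MeasureTheory

/-- The joint-diagonalization cost functional
`f_𝒜(Q) = (1/2) ∑ₖ ∑_{i≠j} |(Q⁻¹ Aₖ Q)_{ij}|²`. -/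
noncomputable def costF {𝕜 : Type*} [RCLike 𝕜] {n K : ℕ}
    (A : Fin K → Matrix (Fin n) (Fin n) 𝕜) (Q : Matrix (Fin n) (Fin n) 𝕜) : ℝ :=
  (1 / 2) * ∑ k, ∑ i, ∑ j, if i ≠ j then ‖(Q⁻¹ * A k * Q) i j‖ ^ 2 else 0


lemma aux_null {E : Type*} [AddGroup E] [MeasurableSpace E] [MeasurableAdd₂ E]
    (ν : Measure E) [SFinite ν] [ν.IsAddLeftInvariant] (S : Set E) (hS : MeasurableSet S)
    (c : ℝ → E) (hc : Measurable c) (h : ∀ x, {t | c t + x ∈ S}.Finite) : ν S = 0 := by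
  have hm : MeasurableSet {p : ℝ × E | c p.1 + p.2 ∈ S} := by
    have : Measurable (fun p : ℝ × E => c p.1 + p.2) := by fun_prop
    exact this hS
  have h0 : ((volume : Measure ℝ).prod ν) {p : ℝ × E | c p.1 + p.2 ∈ S} = 0 := by
    rw [Measure.prod_apply_symm hm]
    have : ∀ y, (volume : Measure ℝ) ((fun x => (x, y)) ⁻¹' {p : ℝ × E | c p.1 + p.2 ∈ S}) = 0 :=
      fun y => (h y).measure_zero _
    simp only [this, lintegral_zero]
  rw [Measure.measure_prod_null hm] at h0
  obtain ⟨t, ht⟩ := h0.exists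
  have := measure_preimage_add ν (c t) S
  rw [← this]
  exact ht

lemma aux_comm {𝕜 : Type*} [RCLike 𝕜] {n K : ℕ} (i0 : Fin n)
    (A : Fin K → Matrix (Fin n) (Fin n) 𝕜) (hA : ∀ k, (A k).IsHermitian)
    (Y : Submodule 𝕜 (Fin n → 𝕜)) (hb : Y ≠ ⊥) (ht : Y ≠ ⊤)
    (hY : ∀ k, ∀ x ∈ Y, (A k).mulVec x ∈ Y) :
    ∃ X : Matrix (Fin n) (Fin n) 𝕜, X i0 i0 = 0 ∧ X ≠ 0 ∧ ∀ k, A k * X = X * A k := by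
  let e := WithLp.linearEquiv 2 𝕜 (Fin n → 𝕜)
  let U : Submodule 𝕜 (EuclideanSpace 𝕜 (Fin n)) := Y.comap e.toLinearMap
  let p : Module.End 𝕜 (EuclideanSpace 𝕜 (Fin n)) := U.starProjection.toLinearMap
  have hp : ∀ v, p v = U.starProjection v := fun v => rfl
  let f := Matrix.toLpLinAlgEquiv (n := Fin n) (R := 𝕜) 2
  have hf : ∀ M v, e (f M v) = M.mulVec (e v) := fun M v => rfl
  have hcomm : ∀ k, f (A k) * p = p * f (A k) := by
    intro k
    have hs : (f (A k)).IsSymmetric := Matrix.isSymmetric_toEuclideanLin_iff.mpr (hA k)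
    have hU : ∀ v ∈ U, f (A k) v ∈ U := fun v hv => hY k _ hv
    have hU' : ∀ v ∈ Uᗮ, f (A k) v ∈ Uᗮ := by
      intro v hv
      rw [Submodule.mem_orthogonal] at hv ⊢
      intro u hu
      rw [← hs u v]
      exact hv _ (hU u hu)
    ext1 v
    simp only [Module.End.mul_apply, hp]
    refine (Submodule.eq_starProjection_of_mem_orthogonal ?_ ?_).symm
    · exact hU _ (Submodule.starProjection_apply_mem _ _)
    · rw [← map_sub]
      exact hU' _ (Submodule.sub_starProjection_mem_orthogonal _)
  let M := f.symm p
  have hM : f M = p := f.apply_symm_apply p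
  refine ⟨M - (M i0 i0) • 1, by simp, ?_, ?_⟩
  · intro h0
    have h1 : M = (M i0 i0) • 1 := sub_eq_zero.mp h0
    generalize M i0 i0 = a at h1
    have hpa : ∀ v, p v = a • v := by
      intro v
      rw [← hM, h1]; simp
    by_cases ha : a = 0
    · apply hb
      rw [eq_bot_iff]
      intro y hy
      have h2 : e.symm y ∈ U := by simpa [U] using hy
      have h3 := Submodule.starProjection_eq_self_iff.mpr h2
      rw [← hp, hpa, ha, zero_smul] at h3
      simpa using h3.symm
    · apply ht
      rw [eq_top_iff]
      intro y _
      have h2 : p (e.symm y) ∈ U := Submodule.starProjection_apply_mem _ _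
      rw [hpa] at h2
      have h3 := (Submodule.smul_mem_iff _ ha).mp h2
      simpa [U] using h3
  · intro k
    have : A k * M = M * A k := by
      apply f.injective
      rw [map_mul, map_mul, hM, hcomm]
    rw [mul_sub, sub_mul, this]; simp

lemma aux_tendsto {𝕜 : Type*} [RCLike 𝕜] {n K : ℕ}
    (A : Fin K → Matrix (Fin n) (Fin n) 𝕜)
    (hA : ¬ ∃ Y : Submodule 𝕜 (Fin n → 𝕜), Y ≠ ⊥ ∧ Y ≠ ⊤ ∧ ∀ k, ∀ x ∈ Y, (A k).mulVec x ∈ Y)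
    (Z : Matrix (Fin n) (Fin n) 𝕜) (hZ : Z ≠ 0) (hr : Z.rank < n)
    (Q : ℕ → Matrix (Fin n) (Fin n) 𝕜) (hQ : ∀ j, IsUnit (Q j)) (hlim : Tendsto Q atTop (𝓝 Z)) :
    Tendsto (fun j => costF A (Q j)) atTop atTop := by
  by_contra hcon
  rw [tendsto_atTop] at hcon
  push Not at hcon
  obtain ⟨C, hC⟩ := hcon
  let l' : Filter ℕ := atTop ⊓ 𝓟 {j | costF A (Q j) < C}
  have : l'.NeBot := by
    rw [← frequently_mem_iff_neBot]
    refine hC.mono fun j hj => ?_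
    simpa using hj
  have hle : l' ≤ atTop := inf_le_left
  have hev : ∀ᶠ j in l', costF A (Q j) < C := mem_inf_of_right (mem_principal_self _)
  have hQt : Tendsto Q l' (𝓝 Z) := hlim.mono_left hle
  have hent : ∀ a b, Tendsto (fun j => Q j a b) l' (𝓝 (Z a b)) := fun a b =>
    ((continuous_apply_apply a b).tendsto Z).comp hQt
  apply hA
  refine ⟨Submodule.span 𝕜 (Set.range Z.col), ?_, ?_, ?_⟩
  · rw [← Matrix.range_mulVecLin]
    intro h
    rw [LinearMap.range_eq_bot] at h
    exact hZ (Matrix.toLin'.injective (by rw [map_zero]; exact h))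
  · rw [← Matrix.range_mulVecLin]
    intro h
    rw [Matrix.rank, h] at hr
    simp at hr
  intro k
  set B : ℕ → Matrix (Fin n) (Fin n) 𝕜 := fun j => (Q j)⁻¹ * A k * Q j with hB
  have hQB : ∀ j, Q j * B j = A k * Q j := by
    intro j
    rw [hB]
    simp only [← mul_assoc]
    rw [Matrix.mul_nonsing_inv _ ((Matrix.isUnit_iff_isUnit_det _).mp (hQ j)), one_mul]
  have hoff : ∀ a b, a ≠ b → (fun j => B j a b) =O[l'] (fun _ => (1 : ℝ)) := by
    intro a b hab
    refine Asymptotics.IsBigO.of_bound (2 * C + 1) (hev.mono fun j hj => ?_)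
    have h1 : ‖B j a b‖ ^ 2 ≤ ∑ k, ∑ i, ∑ j', if i ≠ j' then ‖((Q j)⁻¹ * A k * Q j) i j'‖ ^ 2 else 0 := by
      have e1 : ‖B j a b‖ ^ 2 ≤ ∑ j', if a ≠ j' then ‖((Q j)⁻¹ * A k * Q j) a j'‖ ^ 2 else 0 := by
        have := Finset.single_le_sum (s := Finset.univ)
          (f := fun j' => if a ≠ j' then ‖((Q j)⁻¹ * A k * Q j) a j'‖ ^ 2 else (0 : ℝ))
          (fun i _ => by positivity) (Finset.mem_univ b)
        simpa only [hB, if_pos hab] using this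
      refine e1.trans ((Finset.single_le_sum (s := Finset.univ)
          (f := fun a => ∑ j', if a ≠ j' then ‖((Q j)⁻¹ * A k * Q j) a j'‖ ^ 2 else (0 : ℝ))
          (fun i _ => by positivity) (Finset.mem_univ a)).trans ?_)
      exact Finset.single_le_sum (s := Finset.univ)
          (f := fun k => ∑ a, ∑ j', if a ≠ j' then ‖((Q j)⁻¹ * A k * Q j) a j'‖ ^ 2 else (0 : ℝ))
          (fun i _ => by positivity) (Finset.mem_univ k)
    unfold costF at hj
    simp only [norm_one, mul_one]
    nlinarith [sq_nonneg (‖B j a b‖ - 1), norm_nonneg (B j a b)]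
  have hbig : ∀ a b, (fun j => Q j a b) =O[l'] (fun _ => (1 : ℝ)) := fun a b =>
    (hent a b).isBigO_one ℝ
  have hAQ : ∀ a b, (fun j => (A k * Q j) a b) =O[l'] (fun _ => (1 : ℝ)) := fun a b => by
    have h1 : Tendsto (fun j => A k * Q j) l' (𝓝 (A k * Z)) :=
      ((continuous_const.matrix_mul continuous_id).tendsto Z).comp hQt
    exact (((continuous_apply_apply a b).tendsto (A k * Z)).comp h1).isBigO_one ℝ
  suffices hs : Submodule.span 𝕜 (Set.range Z.col) ≤
      (Submodule.span 𝕜 (Set.range Z.col)).comap (A k).mulVecLin from fun x hx => hs hx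
  rw [Submodule.span_le]
  rintro _ ⟨i, rfl⟩
  rw [SetLike.mem_coe, Submodule.mem_comap, Matrix.mulVecLin_apply]
  by_cases hz : Z.col i = 0
  · rw [hz, Matrix.mulVec_zero]; exact zero_mem _
  obtain ⟨m, hm⟩ : ∃ m, Z m i ≠ 0 := by
    by_contra! h
    exact hz (funext h)
  have hdiag : (fun j => B j i i) =O[l'] (fun _ => (1 : ℝ)) := by
    have h1 : (fun j => (Q j m i)⁻¹ * ((A k * Q j) m i - ∑ l ∈ Finset.univ.erase i, Q j m l * B j l i))
        =O[l'] (fun _ => (1 : ℝ) * 1) := by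
      refine (((hent m i).inv₀ hm).isBigO_one ℝ).mul ((hAQ m i).sub ?_)
      refine Asymptotics.IsBigO.fun_sum fun l hl => ?_
      simpa using (hbig m l).mul (hoff l i (Finset.ne_of_mem_erase hl))
    rw [mul_one] at h1
    refine h1.congr' ?_ EventuallyEq.rfl
    filter_upwards [(hent m i).eventually_ne hm] with j hj
    rw [← hQB, Matrix.mul_apply, ← Finset.add_sum_erase _ _ (Finset.mem_univ i)]
    field_simp
    ring
  have hall : ∀ l, (fun j => B j l i) =O[l'] (fun _ => (1 : ℝ)) := fun l => by
    by_cases h : l = i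
    · subst h; exact hdiag
    · exact hoff l i h
  by_contra hnot
  obtain ⟨φ, hφ, hker⟩ := Submodule.exists_le_ker_of_notMem hnot
  have hφc : Continuous φ := φ.continuous_of_finiteDimensional
  have hcol : ∀ l, Tendsto (fun j => φ ((Q j).col l)) l' (𝓝 0) := fun l => by
    have h0 : φ (Z.col l) = 0 := hker (Submodule.subset_span ⟨l, rfl⟩)
    rw [← h0]
    refine (hφc.tendsto _).comp ?_
    rw [tendsto_pi_nhds]
    exact fun a => hent a l
  have hkey : ∀ j, φ ((A k).mulVec ((Q j).col i)) = ∑ l, B j l i * φ ((Q j).col l) := by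
    intro j
    have : (A k).mulVec ((Q j).col i) = ∑ l, B j l i • (Q j).col l := by
      have h2 : (A k).mulVec ((Q j).col i) = (A k * Q j).col i := by
        ext a; rfl
      rw [h2, ← hQB]
      ext a
      simp [Matrix.mul_apply, Matrix.col, mul_comm]
    rw [this]; simp
  have hl1 : Tendsto (fun j => φ ((A k).mulVec ((Q j).col i))) l' (𝓝 (φ ((A k).mulVec (Z.col i)))) := by
    have h3 : Tendsto (fun j => (Q j).col i) l' (𝓝 (Z.col i)) := by
      rw [tendsto_pi_nhds]
      exact fun a => hent a i
    have h4 : Continuous (fun v => φ ((A k).mulVec v)) :=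
      hφc.comp (continuous_const.matrix_mulVec continuous_id)
    exact (h4.tendsto _).comp h3
  have hl2 : Tendsto (fun j => φ ((A k).mulVec ((Q j).col i))) l' (𝓝 0) := by
    simp only [hkey]
    rw [← Finset.sum_const_zero (s := (Finset.univ : Finset (Fin n)))]
    refine tendsto_finsetSum _ fun l _ => ?_
    have h5 := (hall l).mul_isLittleO ((Asymptotics.isLittleO_one_iff ℝ).mpr (hcol l))
    rw [mul_one] at h5
    exact (Asymptotics.isLittleO_one_iff ℝ).mp h5
  exact hφ (tendsto_nhds_unique hl1 hl2)

/-- the commutator map -/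
def auxL {𝕜 : Type*} [RCLike 𝕜] {n K : ℕ} (i0 : Fin n)
    (A : Fin K → Matrix (Fin n) (Fin n) 𝕜) :
    (LinearMap.ker (Matrix.entryLinearMap 𝕜 𝕜 i0 i0) :
      Submodule 𝕜 (Matrix (Fin n) (Fin n) 𝕜)) →ₗ[𝕜] (Fin K → Matrix (Fin n) (Fin n) 𝕜) where
  toFun X := fun k => A k * X - X * A k
  map_add' X Y := by ext1 k; simp [mul_add, add_mul]; abel
  map_smul' c X := by ext1 k; simp [smul_sub]

lemma auxL_inj {𝕜 : Type*} [RCLike 𝕜] {n K : ℕ} (i0 : Fin n)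
    (A : Fin K → Matrix (Fin n) (Fin n) 𝕜) (k0 k1 : Fin K)
    (h0 : A k0 = Matrix.diagonal (fun i : Fin n => ((i : ℕ) : 𝕜))) (h1 : A k1 = Matrix.of fun _ _ => 1) :
    LinearMap.ker (auxL i0 A) = ⊥ := by
  rw [LinearMap.ker_eq_bot']
  rintro ⟨X, hX⟩ h
  have hX0 : X i0 i0 = 0 := hX
  have e0 : A k0 * X - X * A k0 = 0 := congrFun h k0
  have e1 : A k1 * X - X * A k1 = 0 := congrFun h k1
  have hd : ∀ i j, i ≠ j → X i j = 0 := by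
    intro i j hij
    have := congrFun (congrFun e0 i) j
    rw [h0] at this
    simp only [Matrix.sub_apply, Matrix.diagonal_mul, Matrix.mul_diagonal, Matrix.zero_apply] at this
    have h2 : (((i : ℕ) : 𝕜) - ((j : ℕ) : 𝕜)) * X i j = 0 := by rw [← this]; ring
    rcases mul_eq_zero.mp h2 with h3 | h3
    · exact absurd (Fin.ext (Nat.cast_injective (sub_eq_zero.mp h3))) hij
    · exact h3
  have hii : ∀ i, X i i = 0 := by
    intro i
    have := congrFun (congrFun e1 i0) i
    rw [h1] at this
    simp only [Matrix.sub_apply, Matrix.mul_apply, Matrix.of_apply, one_mul, mul_one,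
      Matrix.zero_apply] at this
    rw [Finset.sum_eq_single i (fun b _ hb => hd b i hb) (by simp),
      Finset.sum_eq_single i0 (fun b _ hb => hd i0 b hb.symm) (by simp), hX0, sub_zero] at this
    exact this
  ext i j
  by_cases hij : i = j
  · subst hij; exact hii i
  · exact hd i j hij

lemma aux_measure {𝕜 : Type*} [RCLike 𝕜] {n K : ℕ} (hn : 2 ≤ n) (hK : 2 ≤ K)
    [MeasurableSpace (selfAdjoint (Matrix (Fin n) (Fin n) 𝕜))]
    [BorelSpace (selfAdjoint (Matrix (Fin n) (Fin n) 𝕜))]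
    (μ : Measure (selfAdjoint (Matrix (Fin n) (Fin n) 𝕜)))
    [μ.IsAddHaarMeasure] [SigmaFinite μ] :
    (Measure.pi fun _ : Fin K => μ) {A : Fin K → selfAdjoint (Matrix (Fin n) (Fin n) 𝕜) |
        ∃ Y : Submodule 𝕜 (Fin n → 𝕜), Y ≠ ⊥ ∧ Y ≠ ⊤ ∧
          ∀ k, ∀ x ∈ Y, (A k : Matrix (Fin n) (Fin n) 𝕜).mulVec x ∈ Y} = 0 := by
  let i0 : Fin n := ⟨0, by omega⟩
  let k0 : Fin K := ⟨0, by omega⟩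
  let k1 : Fin K := ⟨1, by omega⟩
  have hk : k1 ≠ k0 := by simp [k0, k1]
  let H := selfAdjoint (Matrix (Fin n) (Fin n) 𝕜)
  let V : Submodule 𝕜 (Matrix (Fin n) (Fin n) 𝕜) := LinearMap.ker (Matrix.entryLinearMap 𝕜 𝕜 i0 i0)
  have : SecondCountableTopology (Matrix (Fin n) (Fin n) 𝕜) :=
    inferInstanceAs (SecondCountableTopology (Fin n → Fin n → 𝕜))
  have : SecondCountableTopology H :=
    TopologicalSpace.Subtype.secondCountableTopology (H : Set (Matrix (Fin n) (Fin n) 𝕜))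
  let D0 : H := ⟨Matrix.diagonal (fun i : Fin n => ((i : ℕ) : 𝕜)), by
    rw [selfAdjoint.mem_iff, Matrix.star_eq_conjTranspose]
    simp [Matrix.diagonal_conjTranspose, Pi.star_def]⟩
  let D1 : H := ⟨Matrix.of fun _ _ => 1, by
    rw [selfAdjoint.mem_iff, Matrix.star_eq_conjTranspose]
    ext; simp⟩
  let D : Fin K → H := fun k => if k = k0 then D0 else D1
  let L : (Fin K → H) → (V →ₗ[𝕜] (Fin K → Matrix (Fin n) (Fin n) 𝕜)) := fun A =>
    auxL i0 (fun k => (A k : Matrix (Fin n) (Fin n) 𝕜))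
  have hLD : LinearMap.ker (L D) = ⊥ := by
    apply auxL_inj i0 _ k0 k1
    · simp [D, D0]
    · simp [D, hk, D1]
  obtain ⟨R, hR⟩ := (L D).exists_leftInverse_of_injective hLD
  let c : ℝ → (Fin K → H) := fun t => t • D
  have hc : Measurable c := by
    have : Continuous c := by
      refine continuous_pi fun k => ?_
      refine Continuous.subtype_mk (f := fun t : ℝ => t • (D k : Matrix (Fin n) (Fin n) 𝕜)) ?_ _
      fun_prop
    exact this.measurable
  let b := Module.finBasis 𝕜 V
  let S : Set (Fin K → H) := {A | LinearMap.det (R ∘ₗ L A) = 0}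
  have hS : MeasurableSet S := by
    have hcont : Continuous fun A => LinearMap.det (R ∘ₗ L A) := by
      have : (fun A => LinearMap.det (R ∘ₗ L A)) =
          fun A => (LinearMap.toMatrix b b (R ∘ₗ L A)).det := by
        ext A; rw [LinearMap.det_toMatrix]
      rw [this]
      refine Continuous.matrix_det ?_
      refine continuous_matrix fun x y => ?_
      simp only [LinearMap.toMatrix_apply, LinearMap.comp_apply]
      have h1 : Continuous (b.coord x ∘ₗ R) := LinearMap.continuous_of_finiteDimensional _
      refine h1.comp (g := (b.coord x ∘ₗ R)) ?_
      refine continuous_pi fun k => ?_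
      have h2 : Continuous fun A : Fin K → H => (A k : Matrix (Fin n) (Fin n) 𝕜) :=
        continuous_subtype_val.comp (continuous_apply k)
      exact (h2.matrix_mul continuous_const).sub (continuous_const.matrix_mul h2)
    exact (isClosed_singleton.preimage hcont).measurableSet
  refine measure_mono_null (t := S) ?_ ?_
  · rintro A ⟨Y, hb, ht, hY⟩
    obtain ⟨X, hX0, hX, hcomm⟩ := aux_comm i0 (fun k => (A k : Matrix (Fin n) (Fin n) 𝕜))
      (fun k => (A k).2) Y hb ht hY
    by_contra hdet
    have hu := LinearMap.ker_eq_bot'.mp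
      (LinearMap.ker_eq_bot_of_injective ((LinearMap.isUnit_iff_isUnit_det _).mpr
      (isUnit_iff_ne_zero.mpr hdet) |> (Module.End.isUnit_iff _).mp).1) ⟨X, hX0⟩
    apply hX
    refine congrArg Subtype.val (hu ?_)
    have : L A ⟨X, hX0⟩ = 0 := by
      ext1 k
      exact sub_eq_zero.mpr (hcomm k)
    rw [LinearMap.comp_apply, this, map_zero]
  · refine aux_null _ S hS c hc fun A => ?_
    have hfin := Module.End.finite_spectrum (R ∘ₗ L A : Module.End 𝕜 V)
    refine (hfin.preimage (f := fun t : ℝ => (-(t : 𝕜))) ?_).subset ?_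
    · intro s _ t _ hst
      simpa using hst
    · intro t ht
      have hlin : R ∘ₗ L (c t + A) = (t : 𝕜) • 1 + R ∘ₗ L A := by
        have : L (c t + A) = (t : 𝕜) • L D + L A := by
          ext1 X
          ext1 k
          change (((t • D k : H) : Matrix (Fin n) (Fin n) 𝕜) + (A k : Matrix (Fin n) (Fin n) 𝕜)) * (X : Matrix (Fin n) (Fin n) 𝕜)
            - X * (((t • D k : H) : Matrix (Fin n) (Fin n) 𝕜) + A k) =
            (t : 𝕜) • ((D k : Matrix (Fin n) (Fin n) 𝕜) * (X : Matrix (Fin n) (Fin n) 𝕜) - X * D k) + (A k * (X : Matrix (Fin n) (Fin n) 𝕜) - X * A k)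
          have : ((t • D k : H) : Matrix (Fin n) (Fin n) 𝕜) = (t : 𝕜) • (D k : Matrix (Fin n) (Fin n) 𝕜) := by
            ext i j
            exact RCLike.real_smul_eq_coe_mul (K := 𝕜) t ((D k : Matrix (Fin n) (Fin n) 𝕜) i j)
          rw [this, add_mul, mul_add, smul_sub, smul_mul_assoc, mul_smul_comm]
          abel
        rw [this, LinearMap.comp_add, LinearMap.comp_smul, hR]; rfl
      change -(t : 𝕜) ∈ spectrum 𝕜 _
      rw [spectrum.mem_iff, LinearMap.isUnit_iff_isUnit_det, isUnit_iff_ne_zero, not_not]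
      have ht' : LinearMap.det (R ∘ₗ L (c t + A)) = 0 := ht
      rw [hlin] at ht'
      have : (algebraMap 𝕜 (Module.End 𝕜 V)) (-(t : 𝕜)) - R ∘ₗ L A =
          (-1 : 𝕜) • ((t : 𝕜) • 1 + R ∘ₗ L A) := by
        rw [Algebra.algebraMap_eq_smul_one]; module
      rw [this, LinearMap.det_smul, ht', mul_zero]

/-- for a probability measure `𝒫` on `K`-tuples of self-adjoint
matrices that is absolutely continuous with respect to the (product) Lebesgue
(additive Haar) measure on the real linear space of self-adjoint matrices, the set
of tuples possessing a common nontrivial invariant subspace has `𝒫`-measure zero;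
consequently, for `𝒫`-almost every tuple `𝒜`, the functional `f_𝒜(Q)` tends to
infinity as `Q` tends to any fixed nonzero rank-deficient `Z` along invertible
matrices. -/
theorem prob_selfAdjoint_common_invariant_subspace_eq_zero
    {𝕜 : Type*} [RCLike 𝕜] {n K : ℕ} (hn : 2 ≤ n) (hK : 2 ≤ K)
    [MeasurableSpace (selfAdjoint (Matrix (Fin n) (Fin n) 𝕜))]
    [BorelSpace (selfAdjoint (Matrix (Fin n) (Fin n) 𝕜))]
    (μ : Measure (selfAdjoint (Matrix (Fin n) (Fin n) 𝕜)))
    [μ.IsAddHaarMeasure] [SigmaFinite μ]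
    (P : Measure (Fin K → selfAdjoint (Matrix (Fin n) (Fin n) 𝕜)))
    [IsProbabilityMeasure P]
    (hP : P ≪ Measure.pi fun _ : Fin K => μ) :
    P {A : Fin K → selfAdjoint (Matrix (Fin n) (Fin n) 𝕜) |
        ∃ Y : Submodule 𝕜 (Fin n → 𝕜), Y ≠ ⊥ ∧ Y ≠ ⊤ ∧
          ∀ k, ∀ x ∈ Y, (A k : Matrix (Fin n) (Fin n) 𝕜).mulVec x ∈ Y} = 0 ∧
      ∀ᵐ A ∂P, ∀ Z : Matrix (Fin n) (Fin n) 𝕜, Z ≠ 0 → Z.rank < n →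
        ∀ Q : ℕ → Matrix (Fin n) (Fin n) 𝕜, (∀ j, IsUnit (Q j)) →
          Tendsto Q atTop (𝓝 Z) →
          Tendsto (fun j => costF (fun k => (A k : Matrix (Fin n) (Fin n) 𝕜)) (Q j))
            atTop atTop := by
  have h1 := hP (aux_measure hn hK μ)
  refine ⟨h1, ?_⟩
  have h2 := measure_eq_zero_iff_ae_notMem.mp h1
  filter_upwards [h2] with A hA Z hZ hr Q hQ hlim
  exact aux_tendsto _ hA Z hZ hr Q hQ hlim
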